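/- Let A be a J-algebra and a, b, c, d, u, v, x, y ∈ A with c and d functional and (u;v)·(x;y) ≤ c˘;d. (i) If (u˘;x)·(v;y˘) ≤ a˘;b, then (u;v)·(x;y) ≤ ((u;a˘)·(x;b˘));((a;v)·(b;y)). (ii) If in addition a and b are functional, then (u;v)·(x;y) = ((u;a˘)·(x;b˘));((a;v)·(b;y)). (iii) If a and b are functional and 1 = a˘;b, then (u;v)·(x;y) = ((u;a˘)·(x;b˘));((a;v)·(b;y)). -/

import Mathlib

/-- A J-algebra: an algebra (A, ·, 0, 1, ;, ˘, 1') satisfying Jónsson's axioms. -/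
structure JAlgebra (A : Type*) where
  meet : A → A → A        -- Boolean product ·
  comp : A → A → A        -- relative product ;
  conv : A → A            -- converse ˘
  zero : A                -- 0
  one : A                 -- 1
  ident : A               -- 1'
  massoc : ∀ x y z, meet x (meet y z) = meet (meet x y) z
  mcomm : ∀ x y, meet x y = meet y x
  midem : ∀ x, meet x x = x
  cassoc : ∀ x y z, comp x (comp y z) = comp (comp x y) z
  cid : ∀ x, comp x ident = x
  semidist : ∀ x y z, comp (meet x y) z = meet (comp (meet x y) z) (comp y z)
  convconv : ∀ x, conv (conv x) = x
  convcomp : ∀ x y, conv (comp x y) = comp (conv y) (conv x)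
  convmeet : ∀ x y, conv (meet x y) = meet (conv x) (conv y)
  rot : ∀ x y z, meet (comp x y) z =
    meet (comp (meet (comp z (conv y)) x) (meet y (comp (conv x) z))) z
  zbot : ∀ x, meet zero x = zero
  otop : ∀ x, meet x one = x
  comp_zero : ∀ x, comp x zero = zero

/-- x ≤ y iff x·y = x. -/
def JAlgebra.le {A : Type*} (J : JAlgebra A) (x y : A) : Prop := J.meet x y = x

/-- x is functional iff x˘;x ≤ 1'. -/
def JAlgebra.Functional {A : Type*} (J : JAlgebra A) (x : A) : Prop :=
  J.le (J.comp (J.conv x) x) J.ident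

/-- x is permutational iff x;x˘ = 1' = x˘;x. -/
def JAlgebra.Permutational {A : Type*} (J : JAlgebra A) (x : A) : Prop :=
  J.comp x (J.conv x) = J.ident ∧ J.comp (J.conv x) x = J.ident

namespace JAlgebra

variable {A : Type*} (J : JAlgebra A) {p q x y z : A}

theorem le_rfl : J.le x x := J.midem x

variable {J}

theorem le_trans (hxy : J.le x y) (hyz : J.le y z) : J.le x z := by
  unfold le at *
  rw [← hxy, ← J.massoc, hyz]

theorem le_antisymm (hxy : J.le x y) (hyx : J.le y x) : x = y :=
  hxy.symm.trans ((J.mcomm x y).trans hyx)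

variable (J) in
theorem meet_le_left (x y : A) : J.le (J.meet x y) x := by
  unfold le
  rw [J.mcomm x y, ← J.massoc, J.midem]

variable (J) in
theorem meet_le_right (x y : A) : J.le (J.meet x y) y := by
  unfold le
  rw [← J.massoc, J.midem]

theorem le_meet (hx : J.le z x) (hy : J.le z y) : J.le z (J.meet x y) := by
  unfold le at *
  rw [J.massoc, hx, hy]

theorem meet_le_meet (hx : J.le x p) (hy : J.le y q) : J.le (J.meet x y) (J.meet p q) :=
  le_meet (le_trans (J.meet_le_left x y) hx) (le_trans (J.meet_le_right x y) hy)

theorem conv_le_conv (h : J.le x y) : J.le (J.conv x) (J.conv y) := by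
  unfold le at *
  rw [← J.convmeet, h]

theorem comp_le_comp_right (h : J.le x y) (z : A) : J.le (J.comp x z) (J.comp y z) := by
  have key := J.semidist x y z
  rw [h] at key
  exact key.symm

theorem comp_le_comp_left (h : J.le x y) (z : A) : J.le (J.comp z x) (J.comp z y) := by
  have key := conv_le_conv (comp_le_comp_right (conv_le_conv h) (J.conv z))
  simpa only [J.convcomp, J.convconv] using key

theorem comp_le_comp (hx : J.le x p) (hy : J.le y q) : J.le (J.comp x y) (J.comp p q) :=
  le_trans (comp_le_comp_right hx y) (comp_le_comp_left hy p)

variable (J)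

theorem conv_ident_comp (x : A) : J.comp (J.conv J.ident) x = x := by
  have key := congrArg J.conv (J.cid (J.conv x))
  rwa [J.convcomp, J.convconv] at key

theorem conv_ident : J.conv J.ident = J.ident := by
  rw [← J.cid (J.conv J.ident), J.conv_ident_comp]

theorem ident_comp (x : A) : J.comp J.ident x = x := by
  rw [← J.conv_ident, J.conv_ident_comp]

/-- The Dedekind law. -/
theorem comp_meet_le (x y z : A) :
    J.le (J.meet (J.comp x y) z)
      (J.comp (J.meet (J.comp z (J.conv y)) x) (J.meet y (J.comp (J.conv x) z))) := by
  rw [J.rot x y z]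
  exact J.meet_le_left _ _

theorem comp_meet_ident_le (x y : A) :
    J.le (J.meet (J.comp x y) J.ident)
      (J.comp (J.meet x (J.conv y)) (J.conv (J.meet x (J.conv y)))) := by
  have key := J.comp_meet_le x y J.ident
  rwa [J.ident_comp, J.cid, J.mcomm (J.conv y), J.mcomm y,
    ← J.convconv y, ← J.convmeet, J.convconv y] at key

variable {J}

theorem le_comp_conv_of_le_ident (h : J.le x J.ident) : J.le x (J.comp x (J.conv x)) := by
  have key := J.comp_meet_ident_le x J.ident
  rwa [J.cid, J.conv_ident, h] at key

theorem Functional.comp_conv_comp_le (h : J.Functional x) (y z : A) :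
    J.le (J.comp (J.comp y (J.conv x)) (J.comp x z)) (J.comp y z) := by
  have key := comp_le_comp_left (comp_le_comp_right h z) y
  rwa [J.ident_comp, ← J.cassoc, J.cassoc] at key

theorem Functional.conv_comp_le (h : J.Functional x) (z : A) :
    J.le (J.comp (J.conv x) (J.comp x z)) z := by
  have key := comp_le_comp_right h z
  rwa [J.ident_comp, ← J.cassoc] at key

theorem Functional.comp_le (h : J.Functional x) (z : A) :
    J.le (J.comp (J.comp z (J.conv x)) x) z := by
  have key := comp_le_comp_left h z
  rwa [J.cid, J.cassoc] at key

variable (J) in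
theorem le_domain_comp (r : A) :
    J.le r (J.comp (J.meet (J.comp r (J.conv r)) J.ident) r) := by
  have key := J.comp_meet_le J.ident r r
  rw [J.ident_comp, J.midem] at key
  exact le_trans key (comp_le_comp_left (J.meet_le_left _ _) _)

/-- A tabulated element factors through the domain of its table. -/
theorem le_conv_comp_domain_comp {c d p : A} (h : J.le p (J.comp (J.conv c) d)) :
    J.le p (J.comp (J.conv c) (J.comp
      (J.meet (J.comp (J.comp c p) (J.conv d)) J.ident) d)) := by
  have hr : J.le p (J.comp (J.conv c) (J.meet d (J.comp c p))) := by
    have key := J.comp_meet_le (J.conv c) d p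
    rw [J.convconv, J.mcomm, h] at key
    exact le_trans key (comp_le_comp_right (J.meet_le_right _ _) _)
  refine le_trans hr (comp_le_comp_left (le_trans (J.le_domain_comp _) ?_) _)
  exact comp_le_comp
    (meet_le_meet (comp_le_comp (J.meet_le_right _ _) (conv_le_conv (J.meet_le_left _ _))) J.le_rfl)
    (J.meet_le_left _ _)

theorem comp_comp_meet_ident_le {c d p u v : A} (h : J.le p (J.comp u v)) :
    J.le (J.meet (J.comp (J.comp c p) (J.conv d)) J.ident)
      (J.comp (J.meet (J.comp c u) (J.comp d (J.conv v)))
        (J.conv (J.meet (J.comp c u) (J.comp d (J.conv v))))) := by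
  have key := J.comp_meet_ident_le (J.comp c u) (J.comp v (J.conv d))
  rw [J.convcomp v, J.convconv] at key
  refine le_trans (meet_le_meet ?_ J.le_rfl) key
  rw [← J.cassoc c u, J.cassoc u v, J.cassoc c]
  exact comp_le_comp_right (comp_le_comp_left h c) _

/-- Two domain conditions on a subidentity, whose images are linked by `a˘;b`, have a common
witness. -/
theorem le_comp_conv_of_conv_comp_le {e m n a b : A} (he : J.le e J.ident)
    (hm : J.le e (J.comp m (J.conv m))) (hn : J.le e (J.comp n (J.conv n)))
    (hab : J.le (J.comp (J.conv m) n) (J.comp (J.conv a) b)) :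
    J.le e (J.comp (J.meet (J.comp m (J.conv a)) (J.comp n (J.conv b)))
      (J.conv (J.meet (J.comp m (J.conv a)) (J.comp n (J.conv b))))) := by
  have hn' := conv_le_conv hn
  rw [J.convcomp, J.convconv] at hn'
  have hmn : J.le e (J.comp (J.comp m (J.conv a)) (J.comp b (J.conv n))) := by
    refine le_trans (le_comp_conv_of_le_ident he) (le_trans (comp_le_comp hm hn') ?_)
    have key := comp_le_comp_left (comp_le_comp_right hab (J.conv n)) m
    simpa only [J.cassoc] using key
  have key := J.comp_meet_ident_le (J.comp m (J.conv a)) (J.comp b (J.conv n))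
  rw [J.convcomp b, J.convconv] at key
  exact le_trans (le_meet hmn he) key

theorem conv_meet_comp_le {c d u v x y : A} (hc : J.Functional c) (hd : J.Functional d) :
    J.le (J.comp (J.conv (J.meet (J.comp c u) (J.comp d (J.conv v))))
        (J.meet (J.comp c x) (J.comp d (J.conv y))))
      (J.meet (J.comp (J.conv u) x) (J.comp v (J.conv y))) := by
  refine le_meet ?_ ?_
  · refine le_trans (comp_le_comp (conv_le_conv (J.meet_le_left _ _)) (J.meet_le_left _ _)) ?_
    rw [J.convcomp]
    exact hc.comp_conv_comp_le _ _
  · refine le_trans (comp_le_comp (conv_le_conv (J.meet_le_right _ _)) (J.meet_le_right _ _)) ?_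
    rw [J.convcomp, J.convconv]
    exact hd.comp_conv_comp_le _ _

theorem meet_le_of_table {a b c d u v x y : A} (hc : J.Functional c) (hd : J.Functional d)
    (h : J.le (J.meet (J.comp u v) (J.comp x y)) (J.comp (J.conv c) d))
    (hab : J.le (J.meet (J.comp (J.conv u) x) (J.comp v (J.conv y))) (J.comp (J.conv a) b)) :
    J.le (J.meet (J.comp u v) (J.comp x y))
      (J.comp (J.meet (J.comp u (J.conv a)) (J.comp x (J.conv b)))
        (J.meet (J.comp a v) (J.comp b y))) := by
  have he := le_comp_conv_of_conv_comp_le (J.meet_le_right _ _)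
    (comp_comp_meet_ident_le (c := c) (d := d) (J.meet_le_left (J.comp u v) (J.comp x y)))
    (comp_comp_meet_ident_le (J.meet_le_right _ _)) (le_trans (conv_meet_comp_le hc hd) hab)
  refine le_trans (le_conv_comp_domain_comp h)
    (le_trans (comp_le_comp_left (comp_le_comp_right he d) _) ?_)
  rw [← J.cassoc _ _ d, J.cassoc (J.conv c)]
  refine comp_le_comp (le_meet ?_ ?_) (le_meet ?_ ?_)
  · refine le_trans (comp_le_comp_left
      (le_trans (J.meet_le_left _ _) (comp_le_comp_right (J.meet_le_left _ _) _)) _) ?_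
    rw [← J.cassoc c]
    exact hc.conv_comp_le _
  · refine le_trans (comp_le_comp_left
      (le_trans (J.meet_le_right _ _) (comp_le_comp_right (J.meet_le_left _ _) _)) _) ?_
    rw [← J.cassoc c]
    exact hc.conv_comp_le _
  · refine le_trans (comp_le_comp_right (conv_le_conv
      (le_trans (J.meet_le_left _ _) (comp_le_comp_right (J.meet_le_right _ _) _))) _) ?_
    simp only [J.convcomp, J.convconv, J.cassoc]
    exact hd.comp_le _
  · refine le_trans (comp_le_comp_right (conv_le_conv
      (le_trans (J.meet_le_right _ _) (comp_le_comp_right (J.meet_le_right _ _) _))) _) ?_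
    simp only [J.convcomp, J.convconv, J.cassoc]
    exact hd.comp_le _

theorem comp_meet_le_meet_comp {a b : A} (ha : J.Functional a) (hb : J.Functional b)
    (u v x y : A) :
    J.le (J.comp (J.meet (J.comp u (J.conv a)) (J.comp x (J.conv b)))
        (J.meet (J.comp a v) (J.comp b y)))
      (J.meet (J.comp u v) (J.comp x y)) :=
  le_meet
    (le_trans (comp_le_comp (J.meet_le_left _ _) (J.meet_le_left _ _)) (ha.comp_conv_comp_le u v))
    (le_trans (comp_le_comp (J.meet_le_right _ _) (J.meet_le_right _ _)) (hb.comp_conv_comp_le x y))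

end JAlgebra

/-- Prop. (pair2): assume c, d functional and (u;v)·(x;y) ≤ c˘;d.
(i) If (u˘;x)·(v;y˘) ≤ a˘;b then (u;v)·(x;y) ≤ ((u;a˘)·(x;b˘));((a;v)·(b;y)).
(ii) If moreover a, b are functional then equality holds.
(iii) If a, b are functional and 1 = a˘;b then equality holds. -/
theorem pairing_from_table {A : Type*} (J : JAlgebra A) (a b c d u v x y : A)
    (hc : J.Functional c) (hd : J.Functional d)
    (h : J.le (J.meet (J.comp u v) (J.comp x y)) (J.comp (J.conv c) d)) :
    (J.le (J.meet (J.comp (J.conv u) x) (J.comp v (J.conv y))) (J.comp (J.conv a) b) →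
      J.le (J.meet (J.comp u v) (J.comp x y))
        (J.comp (J.meet (J.comp u (J.conv a)) (J.comp x (J.conv b)))
                (J.meet (J.comp a v) (J.comp b y)))) ∧
    (J.le (J.meet (J.comp (J.conv u) x) (J.comp v (J.conv y))) (J.comp (J.conv a) b) →
      J.Functional a → J.Functional b →
      J.meet (J.comp u v) (J.comp x y) =
        J.comp (J.meet (J.comp u (J.conv a)) (J.comp x (J.conv b)))
               (J.meet (J.comp a v) (J.comp b y))) ∧
    (J.Functional a → J.Functional b → J.one = J.comp (J.conv a) b →
      J.meet (J.comp u v) (J.comp x y) =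
        J.comp (J.meet (J.comp u (J.conv a)) (J.comp x (J.conv b)))
               (J.meet (J.comp a v) (J.comp b y))) := by
  refine ⟨JAlgebra.meet_le_of_table hc hd h, fun hab ha hb => ?_, fun ha hb hone => ?_⟩
  · exact JAlgebra.le_antisymm (JAlgebra.meet_le_of_table hc hd h hab)
      (JAlgebra.comp_meet_le_meet_comp ha hb u v x y)
  · refine JAlgebra.le_antisymm (JAlgebra.meet_le_of_table hc hd h ?_)
      (JAlgebra.comp_meet_le_meet_comp ha hb u v x y)
    rw [← hone]
    exact J.otop _
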